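/- arXiv:0905.2732 — 3 statements merged into one kernel-verified Lean document; each statement's English description precedes it below -/
import Mathlib

section
/- For every positive integer i, every real β ≥ 1/2, and every real α ≥ i, the function x ↦ x^α |ψ^{(i)}(x+β)| is strictly increasing on (0, ∞). Conversely, if this function is strictly increasing on (0, ∞) for some β > 0, then α ≥ i. -/
open Real Set MeasureTheory Filter

/-- The k-th polygamma function: the (k+1)-st derivative of log Γ. -/
noncomputable def polygamma (k : ℕ) : ℝ → ℝ :=
  iteratedDeriv (k + 1) (fun x => Real.log (Real.Gamma x))

/-- A function is completely monotonic on (0,∞). -/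
def CompletelyMonotonicOn (f : ℝ → ℝ) : Prop :=
  (∀ k : ℕ, ∀ x : ℝ, 0 < x → 0 ≤ (-1 : ℝ) ^ k * iteratedDeriv k f x)

namespace PG

/-- The series `∑ 1/(y+n)^k`. -/
noncomputable def S (k : ℕ) (y : ℝ) : ℝ := ∑' n : ℕ, ((y + n) ^ k)⁻¹

/-- The digamma series (up to a constant). -/
noncomputable def D (y : ℝ) : ℝ := ∑' n : ℕ, (((1:ℝ) + n)⁻¹ - (y + n)⁻¹)

lemma ypos {y : ℝ} (hy : 0 < y) (n : ℕ) : 0 < y + n := by positivity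

lemma summable_S {k : ℕ} (hk : 2 ≤ k) {y : ℝ} (hy : 0 < y) :
    Summable (fun n : ℕ => ((y + n) ^ k)⁻¹) := by
  have h := (Real.summable_one_div_nat_add_rpow y k).2 (by exact_mod_cast hk)
  refine h.congr fun n => ?_
  rw [Real.rpow_natCast, abs_of_pos (by positivity), one_div, add_comm]

lemma S_pos {k : ℕ} (hk : 2 ≤ k) {y : ℝ} (hy : 0 < y) : 0 < S k y :=
  (summable_S hk hy).tsum_pos (fun n => by positivity) 0 (by simp; positivity)

lemma S_step {k : ℕ} (hk : 2 ≤ k) {y : ℝ} (hy : 0 < y) :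
    S k y = (y ^ k)⁻¹ + S k (y + 1) := by
  unfold S
  rw [(summable_S hk hy).tsum_eq_zero_add]
  simp only [Nat.cast_zero, add_zero, Nat.cast_add, Nat.cast_one]
  congr 2
  ext n
  rw [add_assoc, add_comm (n:ℝ) 1]

lemma hasDerivAt_S {k : ℕ} (hk : 2 ≤ k) {y : ℝ} (hy : 0 < y) :
    HasDerivAt (S k) (-(k * S (k + 1) y)) y := by
  have hm : y ∈ Ioi (y / 2) := by simp; linarith
  have h := hasDerivAt_tsum_of_isPreconnected (𝕜 := ℝ)
    (g := fun (n : ℕ) (z : ℝ) => ((z + n) ^ k)⁻¹)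
    (g' := fun (n : ℕ) (z : ℝ) => -(k * ((z + n) ^ (k + 1))⁻¹))
    (u := fun n : ℕ => k * ((y / 2 + n) ^ (k + 1))⁻¹)
    (t := Ioi (y / 2)) (y₀ := y) (y := y)
    ((summable_S (by omega) (by positivity)).mul_left _) isOpen_Ioi isPreconnected_Ioi
    (fun n z hz => ?_) (fun n z hz => ?_) hm (summable_S hk hy) hm
  · unfold S
    rw [tsum_neg, tsum_mul_left] at h
    exact h
  · have hz' : 0 < z := lt_trans (by positivity) hz
    have hp := ypos hz' n
    have := (((hasDerivAt_id z).add_const (n:ℝ)).pow k).inv (pow_pos (show 0 < id z + (n:ℝ) from hp) k).ne'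
    refine this.congr_deriv ?_
    simp only [id]
    obtain ⟨j, rfl⟩ : ∃ j, k = j + 1 := ⟨k - 1, by omega⟩
    simp
    field_simp
    ring
  · have hz0 : y / 2 < z := hz
    have hz' : 0 < z := lt_trans (by positivity) hz
    rw [norm_neg, Real.norm_of_nonneg (by positivity)]
    gcongr

lemma D_facts {y δ : ℝ} (hδ : 0 < δ) (hδ1 : δ < 1) (hy : δ < y) :
    Summable (fun n : ℕ => ((1:ℝ) + n)⁻¹ - (y + n)⁻¹) ∧ HasDerivAt D (S 2 y) y := by
  have hm : y ∈ Ioi δ := hy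
  have h1 : ∀ (n : ℕ) (z : ℝ), z ∈ Ioi δ →
      HasDerivAt (fun z : ℝ => ((1:ℝ) + n)⁻¹ - (z + n)⁻¹) (((z + n) ^ 2)⁻¹) z := by
    intro n z hz
    have hz' : 0 < z := lt_trans (by positivity) hz
    have hp := ypos hz' n
    have := (((hasDerivAt_id z).add_const (n:ℝ)).inv (by simp only [id]; positivity)).const_sub
      (((1:ℝ) + n)⁻¹)
    refine this.congr_deriv ?_
    simp only [id]
    field_simp
    try ring
  have h2 : ∀ (n : ℕ) (z : ℝ), z ∈ Ioi δ → ‖((z + n) ^ 2)⁻¹‖ ≤ ((δ + n) ^ 2)⁻¹ := by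
    intro n z hz
    have hz0 : δ < z := hz
    have hz' : 0 < z := lt_trans (by positivity) hz
    rw [Real.norm_of_nonneg (by positivity)]
    gcongr
  have h0 : Summable (fun n : ℕ => ((1:ℝ) + n)⁻¹ - ((1:ℝ) + n)⁻¹) := by
    simpa using summable_zero
  refine ⟨summable_of_summable_hasDerivAt_of_isPreconnected
    (g := fun (n : ℕ) (z : ℝ) => ((1:ℝ) + n)⁻¹ - (z + n)⁻¹) (summable_S le_rfl hδ) isOpen_Ioi
    isPreconnected_Ioi h1 h2 (show (1:ℝ) ∈ Ioi δ from hδ1) h0 hm, ?_⟩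
  exact hasDerivAt_tsum_of_isPreconnected
    (g := fun (n : ℕ) (z : ℝ) => ((1:ℝ) + n)⁻¹ - (z + n)⁻¹) (summable_S le_rfl hδ) isOpen_Ioi
    isPreconnected_Ioi h1 h2 (show (1:ℝ) ∈ Ioi δ from hδ1) h0 hm

lemma D_facts' {y : ℝ} (hy : 0 < y) :
    Summable (fun n : ℕ => ((1:ℝ) + n)⁻¹ - (y + n)⁻¹) ∧ HasDerivAt D (S 2 y) y :=
  D_facts (δ := min (1/2) (y/2)) (by positivity) (lt_of_le_of_lt (min_le_left _ _) (by norm_num))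
    (lt_of_le_of_lt (min_le_right _ _) (by linarith))

lemma D_mono : MonotoneOn D (Ioi 0) := by
  intro x hx y hy hxy
  have hx : 0 < x := hx
  have hy : 0 < y := hy
  refine (D_facts' hx).1.tsum_le_tsum (fun n => ?_) (D_facts' hy).1
  gcongr

lemma tendsto_inv_add (x : ℝ) : Tendsto (fun n : ℕ => (x + n)⁻¹) atTop (nhds 0) :=
  tendsto_inv_atTop_zero.comp (tendsto_atTop_add_const_left _ _ tendsto_natCast_atTop_atTop)

lemma D_step {x : ℝ} (hx : 0 < x) : D (x + 1) = D x + x⁻¹ := by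
  have hs := ((D_facts' (show 0 < x + 1 by positivity)).1.sub (D_facts' hx).1)
  have h1 : D (x + 1) - D x = ∑' n : ℕ, ((x + n)⁻¹ - (x + (n + 1 : ℕ))⁻¹) := by
    unfold D
    rw [← (D_facts' (show 0 < x + 1 by positivity)).1.tsum_sub (D_facts' hx).1]
    congr 1; ext n; push_cast
    rw [show x + 1 + (n:ℝ) = x + (n + 1) by ring]; ring
  have h2 : HasSum (fun n : ℕ => ((x + n)⁻¹ - (x + (n + 1 : ℕ))⁻¹)) (x⁻¹) := by
    rw [hasSum_iff_tendsto_nat_of_nonneg]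
    · have : ∀ N : ℕ, ∑ n ∈ Finset.range N, ((x + n)⁻¹ - (x + (n + 1 : ℕ))⁻¹)
          = x⁻¹ - (x + N)⁻¹ := by
        intro N
        rw [Finset.sum_range_sub' (fun n : ℕ => (x + n)⁻¹)]; simp
      simp_rw [this]
      simpa using (tendsto_inv_add x).const_sub x⁻¹
    · intro n
      have := ypos hx n
      rw [sub_nonneg]
      push_cast
      gcongr
      linarith
  rw [h2.tsum_eq] at h1
  linarith

/-- derivative of log Gamma -/
noncomputable def g : ℝ → ℝ := deriv (fun x => Real.log (Real.Gamma x))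

lemma diff_lg {x : ℝ} (hx : 0 < x) :
    DifferentiableAt ℝ (fun x => Real.log (Real.Gamma x)) x := by
  refine (Real.differentiableAt_Gamma fun m => ?_).log (Real.Gamma_pos_of_pos hx).ne'
  have : (0:ℝ) ≤ m := m.cast_nonneg
  intro h; linarith

lemma g_mono : MonotoneOn g (Ioi 0) :=
  Real.convexOn_log_Gamma.monotoneOn_deriv (fun x hx => diff_lg hx)

lemma g_step {x : ℝ} (hx : 0 < x) : g (x + 1) = g x + x⁻¹ := by
  have h1 : HasDerivAt (fun y : ℝ => Real.log (Real.Gamma (y + 1))) (g (x + 1)) x :=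
    (diff_lg (show 0 < x + 1 by positivity)).hasDerivAt.comp_add_const x 1
  have h2 : HasDerivAt (fun y : ℝ => Real.log (Real.Gamma y) + Real.log y) (g x + x⁻¹) x :=
    (diff_lg hx).hasDerivAt.add (Real.hasDerivAt_log hx.ne')
  refine (h1.congr_of_eventuallyEq ?_).unique h2 |>.symm ▸ rfl
  filter_upwards [lt_mem_nhds hx] with y hy
  rw [Real.Gamma_add_one hy.ne', Real.log_mul hy.ne' (Real.Gamma_pos_of_pos hy).ne', add_comm]

lemma h_per {x : ℝ} (hx : 0 < x) (n : ℕ) : g (x + n) - D (x + n) = g x - D x := by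
  induction n with
  | zero => simp
  | succ n ih =>
    rw [← ih]; push_cast
    rw [← add_assoc, g_step (ypos hx n), D_step (ypos hx n)]; ring

lemma h_const_aux {x y : ℝ} (hx : 0 < x) (hxy : x ≤ y) (hy1 : y ≤ x + 1) :
    g y - D y = g x - D x := by
  have hy : 0 < y := by linarith
  have hb : ∀ n : ℕ, |(g y - D y) - (g x - D x)| ≤ (x + n)⁻¹ := by
    intro n
    rw [← h_per hx n, ← h_per hy n]
    have p1 := ypos hx n
    have p2 := ypos hy n
    have p3 : 0 < x + n + 1 := by linarith
    have a1 := g_mono p1 p2 (by linarith)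
    have a2 := g_mono p2 p3 (by linarith)
    have a3 := D_mono p1 p2 (by linarith)
    have a4 := D_mono p2 p3 (by linarith)
    rw [g_step p1] at a2
    rw [D_step p1] at a4
    rw [abs_le]; constructor <;> linarith
  have := ge_of_tendsto' (tendsto_inv_add x) hb
  have := abs_eq_zero.1 (le_antisymm this (abs_nonneg _))
  linarith

lemma h_const {x : ℝ} (hx : 0 < x) : g x = D x + (g 1 - D 1) := by
  -- compare `x` and `1` through a common translate
  obtain ⟨n, hn⟩ := exists_nat_ge x
  have hm := Nat.floor_le (show 0 ≤ x + n - 1 + 1 - x by simp)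
  have key : ∀ k : ℕ, ∀ a b : ℝ, 0 < a → a ≤ b → b ≤ a + k → g b - D b = g a - D a := by
    intro k
    induction k with
    | zero => intro a b ha h1 h2; simp at h2; rw [le_antisymm h2 h1]
    | succ k ih =>
      intro a b ha h1 h2
      push_cast at h2
      by_cases hb : b ≤ a + k
      · exact ih a b ha h1 hb
      · push Not at hb
        rw [h_const_aux (ypos ha k) hb.le (by linarith)]
        exact h_per ha k
  rcases le_total x 1 with h | h
  · have := key 1 x 1 hx h (by push_cast; linarith)
    linarith
  · have := key n 1 x one_pos h (by linarith)
    linarith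

lemma hasDerivAt_g {x : ℝ} (hx : 0 < x) : HasDerivAt g (S 2 x) x := by
  refine ((D_facts' hx).2.add_const (g 1 - D 1)).congr_of_eventuallyEq ?_
  filter_upwards [lt_mem_nhds hx] with y hy
  exact h_const hy

lemma iter (k : ℕ) : ∀ x : ℝ, 0 < x →
    iteratedDeriv (k + 1) g x = (-1) ^ k * (k + 1).factorial * S (k + 2) x := by
  induction k with
  | zero => intro x hx; simp [iteratedDeriv_one, (hasDerivAt_g hx).deriv]
  | succ k ih =>
    intro x hx
    rw [iteratedDeriv_succ]
    have : iteratedDeriv (k + 1) g =ᶠ[nhds x]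
        fun x => (-1) ^ k * (k + 1).factorial * S (k + 2) x := by
      filter_upwards [lt_mem_nhds hx] with y hy
      exact ih y hy
    rw [this.deriv_eq, ((hasDerivAt_S (by omega) hx).const_mul _).deriv]
    rw [Nat.factorial_succ (k + 1)]
    push_cast
    ring

lemma abs_polygamma {i : ℕ} (hi : 1 ≤ i) {x : ℝ} (hx : 0 < x) :
    |polygamma i x| = i.factorial * S (i + 1) x := by
  obtain ⟨k, rfl⟩ : ∃ k, i = k + 1 := ⟨i - 1, by omega⟩
  unfold polygamma
  rw [iteratedDeriv_succ']
  change |iteratedDeriv (k + 1) g x| = _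
  rw [iter k x hx, abs_mul, abs_mul, abs_pow, abs_neg, abs_one, one_pow, one_mul, Nat.abs_cast,
    abs_of_pos (S_pos (by omega) hx)]

/-- `b^(m+1) ≤ a^m - b^m` summed up. -/
lemma diff_formula {y : ℝ} (hy : 0 < y) (m : ℕ) :
    (y⁻¹) ^ m - ((y + 1)⁻¹) ^ m
      = ∑ j ∈ Finset.range m, (y⁻¹) ^ (j + 1) * ((y + 1)⁻¹) ^ (m - j) := by
  rw [← geom_sum₂_mul, Finset.sum_mul]
  refine Finset.sum_congr rfl fun j hj => ?_
  have : y⁻¹ - (y + 1)⁻¹ = y⁻¹ * (y + 1)⁻¹ := by field_simp; ring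
  rw [this, show m - j = (m - 1 - j) + 1 by have := Finset.mem_range.1 hj; omega]
  ring

lemma S_bound {m : ℕ} (hm : 1 ≤ m) {y : ℝ} (hy : 1 ≤ y) :
    S (m + 1) y ≤ 2 ^ m * (y ^ m)⁻¹ := by
  have hy0 : 0 < y := by linarith
  refine Real.tsum_le_of_sum_range_le (fun n => by positivity) fun N => ?_
  have : ∀ n : ℕ, ((y + n) ^ (m + 1))⁻¹ ≤
      2 ^ m * (((y + n) ^ m)⁻¹ - ((y + (n + 1 : ℕ)) ^ m)⁻¹) := by
    intro n
    have hp := ypos hy0 n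
    have hf := diff_formula hp m
    have h1 : (y + n)⁻¹ ^ (0 + 1) * (y + n + 1)⁻¹ ^ (m - 0) ≤
      ∑ j ∈ Finset.range m, ((y + n)⁻¹) ^ (j + 1) * ((y + n + 1)⁻¹) ^ (m - j) :=
      Finset.single_le_sum
        (f := fun j => ((y + n)⁻¹) ^ (j + 1) * ((y + n + 1)⁻¹) ^ (m - j))
        (fun j _ => by positivity) (Finset.mem_range.2 (by omega))
    rw [← hf] at h1
    simp only [zero_add, pow_one, Nat.sub_zero] at h1
    push_cast
    rw [← add_assoc, ← inv_pow, ← inv_pow, ← inv_pow]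
    refine le_trans ?_ (mul_le_mul_of_nonneg_left h1 (by positivity))
    have h2 : (y + n)⁻¹ ≤ 2 * (y + n + 1)⁻¹ := by
      rw [← div_eq_mul_inv, le_div_iff₀ (by positivity), inv_mul_le_iff₀ hp]
      have : (0:ℝ) ≤ n := n.cast_nonneg
      linarith
    calc (y + n)⁻¹ ^ (m + 1) = (y + n)⁻¹ ^ m * (y + n)⁻¹ := pow_succ _ _
      _ ≤ (2 * (y + n + 1)⁻¹) ^ m * (y + n)⁻¹ := by gcongr
      _ = _ := by rw [mul_pow]; ring
  calc _ ≤ ∑ n ∈ Finset.range N, 2 ^ m * (((y + n) ^ m)⁻¹ - ((y + (n + 1 : ℕ)) ^ m)⁻¹) :=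
        Finset.sum_le_sum fun n _ => this n
    _ = 2 ^ m * ((y ^ m)⁻¹ - ((y + N) ^ m)⁻¹) := by
        rw [← Finset.mul_sum, Finset.sum_range_sub' (fun n : ℕ => ((y + n) ^ m)⁻¹)]; simp
    _ ≤ _ := by
        have : 0 < ((y + N) ^ m)⁻¹ := by positivity
        gcongr; linarith

/-- A strictly decreasing sequence argument. -/
lemma pos_of_step (F : ℝ → ℝ) (hF : ∀ y, 0 < y → F (y + 1) < F y)
    (hl : ∀ y, 0 < y → Tendsto (fun n : ℕ => F (y + n)) atTop (nhds 0)) {y : ℝ} (hy : 0 < y) :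
    0 < F y := by
  have ha : StrictAnti (fun n : ℕ => F (y + n)) := by
    refine strictAnti_nat_of_succ_lt fun n => ?_
    have := hF _ (ypos hy n)
    push_cast
    rwa [← add_assoc]
  have h1 : 0 ≤ F (y + (1 : ℕ)) := ha.antitone.le_of_tendsto (hl y hy) 1
  have h2 := hF y hy
  push_cast at h1
  linarith

lemma trap {m : ℕ} (hm : 2 ≤ m) {y : ℝ} (hy : 0 < y) :
    (y⁻¹) ^ m - ((y + 1)⁻¹) ^ m < m / 2 * ((y⁻¹) ^ (m + 1) + ((y + 1)⁻¹) ^ (m + 1)) := by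
  rw [diff_formula hy]
  set a := y⁻¹ with ha
  set b := (y + 1)⁻¹ with hb
  have ha0 : 0 < a := by positivity
  have hb0 : 0 < b := by positivity
  have hab : b < a := by rw [ha, hb]; gcongr; linarith
  have hrefl : ∑ j ∈ Finset.range m, a ^ (j + 1) * b ^ (m - j)
      = ∑ j ∈ Finset.range m, a ^ (m - j) * b ^ (j + 1) := by
    rw [← Finset.sum_range_reflect]
    refine Finset.sum_congr rfl fun j hj => ?_
    have := Finset.mem_range.1 hj
    rw [show m - 1 - j + 1 = m - j by omega, show m - (m - 1 - j) = j + 1 by omega]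
  have hlt : ∑ j ∈ Finset.range m, (a ^ (j + 1) * b ^ (m - j) + a ^ (m - j) * b ^ (j + 1))
      < ∑ j ∈ Finset.range m, (a ^ (m + 1) + b ^ (m + 1)) := by
    have e : ∀ j ∈ Finset.range m, (a ^ (m + 1) + b ^ (m + 1))
        - (a ^ (j + 1) * b ^ (m - j) + a ^ (m - j) * b ^ (j + 1))
        = (a ^ (j + 1) - b ^ (j + 1)) * (a ^ (m - j) - b ^ (m - j)) := by
      intro j hj
      have := Finset.mem_range.1 hj
      rw [show m + 1 = (j + 1) + (m - j) by omega, pow_add, pow_add]; ring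
    refine Finset.sum_lt_sum_of_nonempty ⟨0, Finset.mem_range.2 (by omega)⟩ fun j hj => ?_
    have := Finset.mem_range.1 hj
    have p1 : b ^ (j + 1) < a ^ (j + 1) := by gcongr
    have p2 : b ^ (m - j) < a ^ (m - j) := by gcongr; omega
    have := mul_pos (sub_pos.2 p1) (sub_pos.2 p2)
    rw [← e j hj] at this
    linarith
  rw [Finset.sum_add_distrib, ← hrefl, Finset.sum_const, Finset.card_range, nsmul_eq_mul] at hlt
  linarith

lemma tendsto_pow_inv {m : ℕ} (hm : 1 ≤ m) (y : ℝ) :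
    Tendsto (fun n : ℕ => ((y + n) ^ m)⁻¹) atTop (nhds 0) := by
  have := (tendsto_inv_add y).pow m
  simpa [zero_pow (show m ≠ 0 by omega)] using this

lemma eventually_one_le (y : ℝ) : ∀ᶠ n : ℕ in atTop, 1 ≤ y + n :=
  (tendsto_atTop_add_const_left _ y tendsto_natCast_atTop_atTop).eventually_ge_atTop 1

lemma tendsto_S {m : ℕ} (hm : 1 ≤ m) {y : ℝ} (hy : 0 < y) :
    Tendsto (fun n : ℕ => S (m + 1) (y + n)) atTop (nhds 0) := by
  have h := (tendsto_pow_inv hm y).const_mul ((2:ℝ) ^ m)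
  rw [mul_zero] at h
  refine tendsto_of_tendsto_of_tendsto_of_le_of_le' tendsto_const_nhds h ?_ ?_
  · exact Eventually.of_forall fun n => (S_pos (by omega) (ypos hy n)).le
  · filter_upwards [eventually_one_le y] with n hn using S_bound hm hn

lemma tendsto_mul_S {m : ℕ} (hm : 2 ≤ m) {y : ℝ} (hy : 0 < y) :
    Tendsto (fun n : ℕ => (y + n) * S (m + 1) (y + n)) atTop (nhds 0) := by
  have h := (tendsto_pow_inv (m := m - 1) (by omega) y).const_mul ((2:ℝ) ^ m)
  rw [mul_zero] at h
  refine tendsto_of_tendsto_of_tendsto_of_le_of_le' tendsto_const_nhds h ?_ ?_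
  · exact Eventually.of_forall fun n =>
      mul_nonneg (ypos hy n).le (S_pos (by omega) (ypos hy n)).le
  · filter_upwards [eventually_one_le y] with n hn
    have hp := ypos hy n
    have := mul_le_mul_of_nonneg_left (S_bound (show 1 ≤ m by omega) hn) hp.le
    refine this.trans (le_of_eq ?_)
    obtain ⟨j, rfl⟩ : ∃ j, m = j + 1 := ⟨m - 1, by omega⟩
    simp only [Nat.add_sub_cancel]
    field_simp
    ring

lemma G_pos {m : ℕ} (hm : 2 ≤ m) {y : ℝ} (hy : 0 < y) :
    0 < m * S (m + 1) y - (y ^ m)⁻¹ - m / 2 * (y ^ (m + 1))⁻¹ := by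
  refine pos_of_step (fun y => m * S (m + 1) y - (y ^ m)⁻¹ - m / 2 * (y ^ (m + 1))⁻¹) ?_ ?_ hy
  · intro y hy
    have := trap hm hy
    simp only [inv_pow] at this
    have h2 := S_step (show 2 ≤ m + 1 by omega) hy
    simp only [h2]
    linarith
  · intro y hy
    have := (((tendsto_S (m := m) (by omega) hy).const_mul (m:ℝ)).sub
      (tendsto_pow_inv (m := m) (by omega) y)).sub
      ((tendsto_pow_inv (m := m + 1) (by omega) y).const_mul ((m:ℝ) / 2))
    simpa using this

lemma F_pos {i : ℕ} (hi : 1 ≤ i) {y : ℝ} (hy : 0 < y) :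
    0 < i * S (i + 1) y - (i + 1) * (y - 1 / 2) * S (i + 2) y := by
  refine pos_of_step (fun y => i * S (i + 1) y - (i + 1) * (y - 1 / 2) * S (i + 2) y) ?_ ?_ hy
  · intro y hy
    have hG := G_pos (show 2 ≤ i + 1 by omega) hy
    have h1 := S_step (show 2 ≤ i + 1 by omega) hy
    have h2 := S_step (show 2 ≤ i + 2 by omega) hy
    have e : (y ^ (i + 1))⁻¹ = y * (y ^ (i + 2))⁻¹ := by field_simp; ring
    have h1' : S (i + 1) (y + 1) = S (i + 1) y - y * (y ^ (i + 2))⁻¹ := by linarith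
    have h2' : S (i + 2) (y + 1) = S (i + 2) y - (y ^ (i + 2))⁻¹ := by linarith
    simp only [h1', h2']
    rw [e] at hG
    push_cast at hG
    simp only [show i + 1 + 1 = i + 2 from rfl] at hG
    nlinarith
  · intro y hy
    have a1 := (tendsto_S (m := i) hi hy).const_mul (i:ℝ)
    have a2 := (tendsto_mul_S (m := i + 1) (by omega) hy).const_mul ((i:ℝ) + 1)
    have a3 := (tendsto_S (m := i + 1) (by omega) hy).const_mul (((i:ℝ) + 1) / 2)
    have := (a1.sub a2).add a3
    simp only [mul_zero, sub_zero, add_zero] at this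
    refine this.congr fun n => ?_
    ring

lemma part1 {i : ℕ} (hi : 1 ≤ i) {α β : ℝ} (hβ : 1 / 2 ≤ β) (hα : (i : ℝ) ≤ α) :
    StrictMonoOn (fun x : ℝ => x ^ α * S (i + 1) (x + β)) (Ioi 0) := by
  have hd : ∀ x : ℝ, 0 < x → HasDerivAt (fun x : ℝ => x ^ α * S (i + 1) (x + β))
      (α * x ^ (α - 1) * S (i + 1) (x + β)
        + x ^ α * (-((i + 1 : ℕ) * S (i + 2) (x + β)))) x := by
    intro x hx
    exact (Real.hasDerivAt_rpow_const (Or.inl hx.ne')).mul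
      ((hasDerivAt_S (show 2 ≤ i + 1 by omega) (show 0 < x + β by linarith)).comp_add_const x β)
  refine strictMonoOn_of_deriv_pos (convex_Ioi 0)
    (fun x hx => (hd x hx).continuousAt.continuousWithinAt) fun x hx => ?_
  rw [interior_Ioi] at hx
  have hx : 0 < x := hx
  have hy : 0 < x + β := by linarith
  rw [(hd x hx).deriv]
  have e : x ^ α = x ^ (α - 1) * x := by
    rw [← Real.rpow_add_one hx.ne']; ring_nf
  rw [e]
  have hF := F_pos hi hy
  have s1 := S_pos (show 2 ≤ i + 1 by omega) hy
  have s2 := S_pos (show 2 ≤ i + 2 by omega) hy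
  have q1 : i * S (i + 1) (x + β) ≤ α * S (i + 1) (x + β) := by gcongr
  have q2 : (i + 1) * x * S (i + 2) (x + β) ≤ (i + 1) * (x + β - 1 / 2) * S (i + 2) (x + β) := by
    gcongr; linarith
  have hp : 0 < x ^ (α - 1) := Real.rpow_pos_of_pos hx _
  have : 0 < x ^ (α - 1) * (α * S (i + 1) (x + β) - (i + 1) * x * S (i + 2) (x + β)) :=
    mul_pos hp (by linarith)
  push_cast
  linarith

lemma part2 {i : ℕ} (hi : 1 ≤ i) {α β : ℝ} (hβ : 0 < β)
    (h : StrictMonoOn (fun x : ℝ => x ^ α * S (i + 1) (x + β)) (Ioi 0)) : (i : ℝ) ≤ α := by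
  by_contra! hlt
  have ht : Tendsto (fun x : ℝ => (2:ℝ) ^ i * x ^ (-(i - α))) atTop (nhds 0) := by
    simpa using (tendsto_rpow_neg_atTop (show 0 < i - α by linarith)).const_mul ((2:ℝ) ^ i)
  have hc : (1:ℝ) ^ α * S (i + 1) (1 + β) ≤ 0 := by
    refine ge_of_tendsto ht ?_
    filter_upwards [eventually_ge_atTop 1] with x hx
    have hx0 : 0 < x := by linarith
    refine (h.monotoneOn (show (1:ℝ) ∈ Ioi 0 by simp) hx0 hx).trans ?_
    calc x ^ α * S (i + 1) (x + β) ≤ x ^ α * (2 ^ i * ((x + β) ^ i)⁻¹) := by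
          gcongr; exact S_bound hi (by linarith)
      _ ≤ x ^ α * (2 ^ i * (x ^ i)⁻¹) := by gcongr; linarith
      _ = _ := by
          rw [neg_sub, Real.rpow_sub hx0, Real.rpow_natCast]; ring
  have := S_pos (show 2 ≤ i + 1 by omega) (show 0 < 1 + β by linarith)
  rw [Real.one_rpow] at hc
  linarith

lemma mono_iff {i : ℕ} (hi : 1 ≤ i) {α β : ℝ} (hβ : 0 < β) :
    StrictMonoOn (fun x : ℝ => x ^ α * |polygamma i (x + β)|) (Ioi 0) ↔
    StrictMonoOn (fun x : ℝ => x ^ α * S (i + 1) (x + β)) (Ioi 0) := by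
  have hf : (0:ℝ) < i.factorial := by exact_mod_cast i.factorial_pos
  refine forall₂_congr fun a ha => forall₂_congr fun b hb => ?_
  have ha : 0 < a := ha
  have hb : 0 < b := hb
  simp only
  rw [abs_polygamma hi (by linarith), abs_polygamma hi (by linarith),
    mul_left_comm, mul_left_comm (b ^ α), mul_lt_mul_iff_right₀ hf]

end PG

theorem stmt_11 (i : ℕ) (hi : 1 ≤ i) (α β : ℝ) :
    ((1 / 2 ≤ β ∧ (i : ℝ) ≤ α) →
      StrictMonoOn (fun x : ℝ => x ^ α * |polygamma i (x + β)|) (Set.Ioi 0)) ∧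
    ((0 < β ∧ StrictMonoOn (fun x : ℝ => x ^ α * |polygamma i (x + β)|) (Set.Ioi 0)) →
      (i : ℝ) ≤ α) := by
  refine ⟨fun ⟨hβ, hα⟩ => ?_, fun ⟨hβ, h⟩ => ?_⟩
  · exact (PG.mono_iff hi (by linarith)).2 (PG.part1 hi hβ hα)
  · exact PG.part2 hi hβ ((PG.mono_iff hi hβ).1 h)
end

section
/- For every positive integer i and every real α ≤ i, the function x ↦ x |ψ^{(i+1)}(x)| - α |ψ^{(i)}(x)| is completely monotonic on (0, ∞). -/
open Real Set MeasureTheory Filter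

open Topology

/-- The Hurwitz type sum. -/
noncomputable def hurw (p : ℕ) (x : ℝ) : ℝ := ∑' n : ℕ, ((x + n) ^ p)⁻¹

lemma summable_bound (p : ℕ) (hp : 2 ≤ p) (c : ℝ) :
    Summable (fun n : ℕ => c * (((n : ℝ) + 1) ^ p)⁻¹) := by
  apply Summable.mul_left
  have h := (summable_nat_add_iff 1).2 (Real.summable_nat_pow_inv.2 (by omega : 1 < p))
  simpa using h

lemma lower_aux (δ y : ℝ) (hδ : 0 < δ) (hδ1 : δ ≤ 1) (hy : δ ≤ y) (n : ℕ) :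
    δ * ((n : ℝ) + 1) ≤ y + n := by
  have : (0 : ℝ) ≤ n := n.cast_nonneg
  nlinarith

lemma inv_bound (p : ℕ) (δ y : ℝ) (hδ : 0 < δ) (hδ1 : δ ≤ 1) (hy : δ ≤ y) (n : ℕ) :
    ((y + n) ^ p)⁻¹ ≤ (δ ^ p)⁻¹ * (((n : ℝ) + 1) ^ p)⁻¹ := by
  rw [← mul_inv, ← mul_pow]
  have h := lower_aux δ y hδ hδ1 hy n
  gcongr

lemma hurw_summable (p : ℕ) (hp : 2 ≤ p) (x : ℝ) (hx : 0 < x) :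
    Summable (fun n : ℕ => ((x + n) ^ p)⁻¹) := by
  refine Summable.of_nonneg_of_le (fun n => by positivity)
    (fun n => inv_bound p (min x 1) x (by positivity) (min_le_right _ _) (min_le_left _ _) n)
    (summable_bound p hp _)

lemma hasDerivAt_inv_pow (p : ℕ) (y : ℝ) (hy : 0 < y) (n : ℕ) :
    HasDerivAt (fun z : ℝ => ((z + n) ^ p)⁻¹) (-(p : ℝ) * ((y + n) ^ (p + 1))⁻¹) y := by
  have h0 : y + n ≠ 0 := by positivity
  have h := (((hasDerivAt_id y).add_const (n : ℝ)).pow p).inv (pow_ne_zero p h0)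
  refine h.congr_deriv ?_
  rcases p with _ | p
  · simp
  · simp only [id, Nat.add_sub_cancel]
    simp
    field_simp
    ring

lemma hurw_hasDerivAt (p : ℕ) (hp : 2 ≤ p) (x : ℝ) (hx : 0 < x) :
    HasDerivAt (hurw p) (-(p : ℝ) * hurw (p + 1) x) x := by
  have hδ : 0 < min x 1 / 2 := by positivity
  have hδ1 : min x 1 / 2 ≤ 1 := by linarith [min_le_right x 1]
  have hδx : min x 1 / 2 < x := by
    have := min_le_left x 1
    have : 0 < min x 1 := by positivity
    linarith
  have h := hasDerivAt_tsum_of_isPreconnected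
    (g := fun (n : ℕ) (z : ℝ) => ((z + n) ^ p)⁻¹)
    (g' := fun (n : ℕ) (y : ℝ) => -(p : ℝ) * ((y + n) ^ (p + 1))⁻¹)
    (t := Ioi (min x 1 / 2)) (y₀ := x) (y := x)
    (summable_bound (p + 1) (by omega) (p * ((min x 1 / 2) ^ (p + 1))⁻¹))
    isOpen_Ioi isPreconnected_Ioi
    (fun n y hy => hasDerivAt_inv_pow p y (hδ.trans hy) n)
    (fun n y hy => by
      have hy0 : 0 < y := hδ.trans hy
      rw [Real.norm_eq_abs, abs_mul, abs_neg, Nat.abs_cast, abs_of_nonneg (by positivity), mul_assoc]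
      exact mul_le_mul_of_nonneg_left (inv_bound (p + 1) _ y hδ hδ1 (le_of_lt hy) n) (by positivity))
    hδx (hurw_summable p hp x hx) hδx
  rw [tsum_mul_left] at h
  exact h

/-- Weierstrass term. -/
noncomputable def wterm (n : ℕ) (x : ℝ) : ℝ := (x - 1) / (n + 1) - log (x + n) + log (n + 1)

/-- Derivative of the Weierstrass term. -/
noncomputable def wderiv (n : ℕ) (x : ℝ) : ℝ := 1 / ((n : ℝ) + 1) - 1 / (x + n)

lemma wterm_hasDerivAt (n : ℕ) (y : ℝ) (hy : 0 < y) : HasDerivAt (wterm n) (wderiv n y) y := by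
  have h0 : y + n ≠ 0 := by positivity
  have h1 := (((hasDerivAt_id y).sub_const 1).div_const ((n : ℝ) + 1))
  have h2 := ((hasDerivAt_id y).add_const (n : ℝ)).log h0
  exact (h1.sub h2).add_const (log (n + 1))

lemma wderiv_bound (δ R y : ℝ) (hδ : 0 < δ) (hδ1 : δ ≤ 1) (hy : δ ≤ y) (hR : y ≤ R) (n : ℕ) :
    ‖wderiv n y‖ ≤ (R + 1) / δ * (((n : ℝ) + 1) ^ 2)⁻¹ := by
  have hy0 : 0 < y := hδ.trans_le hy
  have h := lower_aux δ y hδ hδ1 hy n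
  have e : wderiv n y = (y - 1) / ((n + 1) * (y + n)) := by
    unfold wderiv
    have : y + n ≠ 0 := by positivity
    field_simp
    ring
  rw [e, norm_div, Real.norm_eq_abs, Real.norm_eq_abs, abs_of_pos (a := (n + 1) * (y + n)) (by positivity)]
  have e2 : (R + 1) / δ * (((n : ℝ) + 1) ^ 2)⁻¹ = (R + 1) / ((n + 1) * (δ * (n + 1))) := by
    field_simp
  rw [e2]
  have : |y - 1| ≤ R + 1 := by rw [abs_le]; constructor <;> linarith
  have hR1 : 0 ≤ R + 1 := by linarith
  gcongr

lemma w_both (x : ℝ) (hx : 0 < x) : Summable (fun n => wterm n x) ∧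
    HasDerivAt (fun z => ∑' n, wterm n z) (∑' n, wderiv n x) x := by
  have hδ : 0 < min x 1 / 2 := by positivity
  have hm : 0 < min x 1 := by positivity
  have hδ1 : min x 1 / 2 < 1 := by linarith [min_le_right x 1]
  have hδx : min x 1 / 2 < x := by linarith [min_le_left x 1]
  have hmem : x ∈ Ioo (min x 1 / 2) (x + 1) := ⟨hδx, by linarith⟩
  have hmem1 : (1 : ℝ) ∈ Ioo (min x 1 / 2) (x + 1) := ⟨hδ1, by linarith⟩
  have h1 : Summable (fun n => wterm n 1) := by
    have : (fun n => wterm n 1) = fun _ => 0 := by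
      funext n
      simp [wterm, add_comm]
    rw [this]
    exact summable_zero
  have hb := summable_bound 2 le_rfl ((x + 1 + 1) / (min x 1 / 2))
  have hg : ∀ (n : ℕ) y, y ∈ Ioo (min x 1 / 2) (x + 1) → HasDerivAt (wterm n) (wderiv n y) y :=
    fun n y hy => wterm_hasDerivAt n y (hδ.trans hy.1)
  have hg' : ∀ (n : ℕ) y, y ∈ Ioo (min x 1 / 2) (x + 1) →
      ‖wderiv n y‖ ≤ (x + 1 + 1) / (min x 1 / 2) * (((n : ℝ) + 1) ^ 2)⁻¹ :=
    fun n y hy => wderiv_bound _ _ y hδ hδ1.le hy.1.le hy.2.le n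
  exact ⟨summable_of_summable_hasDerivAt_of_isPreconnected hb isOpen_Ioo isPreconnected_Ioo hg hg'
      hmem1 h1 hmem,
    hasDerivAt_tsum_of_isPreconnected hb isOpen_Ioo isPreconnected_Ioo hg hg' hmem1 h1 hmem⟩

lemma wderiv_hasDerivAt (x : ℝ) (hx : 0 < x) :
    HasDerivAt (fun z => ∑' n, wderiv n z) (hurw 2 x) x := by
  have hδ : 0 < min x 1 / 2 := by positivity
  have hm : 0 < min x 1 := by positivity
  have hδ1 : min x 1 / 2 < 1 := by linarith [min_le_right x 1]
  have hδx : min x 1 / 2 < x := by linarith [min_le_left x 1]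
  refine hasDerivAt_tsum_of_isPreconnected
    (g' := fun (n : ℕ) (y : ℝ) => ((y + n) ^ 2)⁻¹)
    (t := Ioi (min x 1 / 2)) (y₀ := 1) (y := x)
    (summable_bound 2 le_rfl (((min x 1 / 2) ^ 2)⁻¹))
    isOpen_Ioi isPreconnected_Ioi ?_ ?_ hδ1 ?_ hδx
  · intro n y hy
    have h := (hasDerivAt_inv_pow 1 y (hδ.trans hy) n).const_sub (1 / ((n : ℝ) + 1))
    have e : wderiv n = fun z : ℝ => 1 / ((n : ℝ) + 1) - ((z + n) ^ 1)⁻¹ := by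
      funext z
      simp [wderiv]
    rw [e]
    exact h.congr_deriv (by simp)
  · intro n y hy
    have hy0 : 0 < y := hδ.trans hy
    rw [Real.norm_eq_abs, abs_of_nonneg (by positivity)]
    exact inv_bound 2 _ y hδ hδ1.le (le_of_lt hy) n
  · have : (fun n => wderiv n 1) = fun _ => 0 := by
      funext n
      simp [wderiv, add_comm]
    rw [this]
    exact summable_zero

lemma partial_sum (x : ℝ) (n : ℕ) :
    ∑ m ∈ Finset.range (n + 1), wterm m x = BohrMollerup.logGammaSeq x n
      + (x - 1) * ((harmonic (n + 1) : ℝ) - log ((n + 1 : ℕ) : ℝ))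
      + x * (log ((n : ℝ) + 1) - log n) := by
  have h1 : ∑ m ∈ Finset.range (n + 1), log ((m : ℝ) + 1) = log (n.factorial) + log ((n : ℝ) + 1) := by
    rw [Finset.sum_range_succ]
    congr 1
    induction n with
    | zero => simp
    | succ k ih =>
      rw [Finset.sum_range_succ, ih, Nat.factorial_succ, Nat.cast_mul, Real.log_mul (by positivity) (by positivity)]
      push_cast
      ring
  have h2 : ∑ m ∈ Finset.range (n + 1), (x - 1) / ((m : ℝ) + 1) = (x - 1) * (harmonic (n + 1) : ℝ) := by
    rw [harmonic]
    push_cast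
    rw [Finset.mul_sum]
    rfl
  unfold wterm BohrMollerup.logGammaSeq
  rw [Finset.sum_add_distrib, Finset.sum_sub_distrib, h1, h2]
  push_cast
  ring

lemma logGamma_eq (x : ℝ) (hx : 0 < x) :
    log (Gamma x) = ∑' n, wterm n x - (x - 1) * eulerMascheroniConstant := by
  have h1 := ((w_both x hx).1.hasSum.tendsto_sum_nat).comp (tendsto_add_atTop_nat 1)
  have h2 := ((BohrMollerup.tendsto_log_gamma hx).add
    (((tendsto_harmonic_sub_log).comp (tendsto_add_atTop_nat 1)).const_mul (x - 1))).add
    ((Real.tendsto_log_nat_add_one_sub_log).const_mul x)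
  have h3 := tendsto_nhds_unique (h1.congr (fun n => by
    simp only [Function.comp]
    exact partial_sum x n)) h2
  rw [h3]
  ring

lemma polygamma_eq (j : ℕ) (x : ℝ) (hx : 0 < x) :
    polygamma (j + 1) x = (-1) ^ j * ((j + 1).factorial : ℝ) * hurw (j + 2) x := by
  unfold polygamma
  induction j generalizing x with
  | zero =>
    have h1 : ∀ y : ℝ, 0 < y → iteratedDeriv 1 (fun x => Real.log (Real.Gamma x)) y
        = ∑' n, wderiv n y - eulerMascheroniConstant := by
      intro y hy
      rw [iteratedDeriv_one]
      have e : (fun x => Real.log (Real.Gamma x)) =ᶠ[𝓝 y]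
          fun x => ∑' n, wterm n x - (x - 1) * eulerMascheroniConstant := by
        filter_upwards [lt_mem_nhds hy] with z hz using logGamma_eq z hz
      rw [e.deriv_eq]
      have h := (w_both y hy).2.sub (((hasDerivAt_id y).sub_const 1).mul_const eulerMascheroniConstant)
      rw [one_mul] at h
      exact h.deriv
    rw [zero_add, iteratedDeriv_succ]
    have e : iteratedDeriv 1 (fun x => Real.log (Real.Gamma x)) =ᶠ[𝓝 x]
        fun x => ∑' n, wderiv n x - eulerMascheroniConstant := by
      filter_upwards [lt_mem_nhds hx] with z hz using h1 z hz
    rw [e.deriv_eq, ((wderiv_hasDerivAt x hx).sub_const eulerMascheroniConstant).deriv]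
    simp
  | succ j ih =>
    rw [iteratedDeriv_succ]
    have e : iteratedDeriv (j + 1 + 1) (fun x => Real.log (Real.Gamma x)) =ᶠ[𝓝 x]
        fun x => (-1) ^ j * ((j + 1).factorial : ℝ) * hurw (j + 2) x := by
      filter_upwards [lt_mem_nhds hx] with z hz using ih z hz
    rw [e.deriv_eq, ((hurw_hasDerivAt (j + 2) (by omega) x hx).const_mul _).deriv,
      Nat.factorial_succ (j + 1)]
    push_cast
    ring

/-- Absolute value of polygamma. -/
noncomputable def pg (j : ℕ) (x : ℝ) : ℝ := (j.factorial : ℝ) * hurw (j + 1) x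

lemma hurw_nonneg (p : ℕ) (x : ℝ) (hx : 0 < x) : 0 ≤ hurw p x :=
  tsum_nonneg (fun n => by positivity)

lemma abs_polygamma (j : ℕ) (hj : 1 ≤ j) (x : ℝ) (hx : 0 < x) : |polygamma j x| = pg j x := by
  obtain ⟨j, rfl⟩ := Nat.exists_eq_add_of_le' hj
  rw [polygamma_eq j x hx, abs_mul, abs_mul, abs_pow, abs_neg, abs_one, one_pow, one_mul,
    Nat.abs_cast, abs_of_nonneg (hurw_nonneg _ x hx)]
  rfl

lemma pg_hasDerivAt (j : ℕ) (hj : 1 ≤ j) (x : ℝ) (hx : 0 < x) :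
    HasDerivAt (pg j) (- pg (j + 1) x) x := by
  refine ((hurw_hasDerivAt (j + 1) (by omega) x hx).const_mul (j.factorial : ℝ)).congr_deriv ?_
  unfold pg
  rw [Nat.factorial_succ]
  push_cast
  ring

lemma tangent_ineq (p : ℕ) (z : ℝ) (hz : 0 < z) :
    ((z + 1) ^ p)⁻¹ + p * ((z + 1) ^ (p + 1))⁻¹ ≤ (z ^ p)⁻¹ := by
  have hb := one_add_mul_le_pow (a := 1 / z) (by have : 0 < 1 / z := by positivity
                                                 linarith) p
  have h2 : (1 : ℝ) + p * (1 / (z + 1)) ≤ 1 + p * (1 / z) := by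
    gcongr
    linarith
  have h3 : (1 + 1 / z) ^ p * ((z + 1) ^ p)⁻¹ = (z ^ p)⁻¹ := by
    rw [show 1 + 1 / z = (z + 1) / z by field_simp, div_pow]
    field_simp
  rw [← h3]
  calc _ = (1 + p * (1 / (z + 1))) * ((z + 1) ^ p)⁻¹ := by
        field_simp
        ring
    _ ≤ _ := by
        gcongr
        exact h2.trans hb

lemma partial_lower (p : ℕ) (x : ℝ) (hx : 0 < x) (N : ℕ) :
    ((N : ℝ) + 1) * ((x + N) ^ p)⁻¹ ≤
      ∑ n ∈ Finset.range (N + 1), (((x + n) ^ p)⁻¹ - p * (n * ((x + n) ^ (p + 1))⁻¹)) := by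
  induction N with
  | zero => simp
  | succ N ih =>
    rw [Finset.sum_range_succ]
    have h := tangent_ineq p (x + N) (by positivity)
    have h' := mul_le_mul_of_nonneg_left h (show (0 : ℝ) ≤ N + 1 by positivity)
    push_cast
    rw [show x + ((N : ℝ) + 1) = x + N + 1 by ring]
    linarith

lemma key (m : ℕ) (hm : 1 ≤ m) (x : ℝ) (hx : 0 < x) : (m : ℝ) * pg m x ≤ x * pg (m + 1) x := by
  have s1 := (hurw_summable (m + 1) (by omega) x hx).hasSum.mul_left (m : ℝ)
  have s2 := (hurw_summable (m + 2) (by omega) x hx).hasSum.mul_left (((m : ℝ) + 1) * x)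
  have s := (s2.sub s1).tendsto_sum_nat.comp (tendsto_add_atTop_nat 1)
  have h0 : 0 ≤ ((m : ℝ) + 1) * x * hurw (m + 2) x - m * hurw (m + 1) x := by
    refine ge_of_tendsto' s (fun N => ?_)
    simp only [Function.comp]
    refine le_trans ?_ ((partial_lower (m + 1) x hx N).trans (le_of_eq ?_))
    · positivity
    · refine Finset.sum_congr rfl (fun n _ => ?_)
      have : x + n ≠ 0 := by positivity
      push_cast
      field_simp
      ring
  unfold pg
  rw [Nat.factorial_succ]
  push_cast
  have := mul_nonneg (Nat.cast_nonneg (α := ℝ) m.factorial) h0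
  linarith

theorem stmt_13 (i : ℕ) (hi : 1 ≤ i) (α : ℝ) (hα : α ≤ i) :
    CompletelyMonotonicOn (fun x : ℝ => x * |polygamma (i + 1) x| - α * |polygamma i x|) := by
  intro k x hx
  have main : ∀ (k : ℕ) (x : ℝ), 0 < x →
      iteratedDeriv k (fun x : ℝ => x * |polygamma (i + 1) x| - α * |polygamma i x|) x
        = (-1) ^ k * (x * pg (i + k + 1) x - (k + α) * pg (i + k) x) := by
    intro k
    induction k with
    | zero =>
      intro x hx
      simp [abs_polygamma i hi x hx, abs_polygamma (i + 1) (by omega) x hx]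
    | succ k ih =>
      intro x hx
      rw [iteratedDeriv_succ]
      have e : iteratedDeriv k (fun x : ℝ => x * |polygamma (i + 1) x| - α * |polygamma i x|) =ᶠ[𝓝 x]
          fun x => (-1) ^ k * (x * pg (i + k + 1) x - (k + α) * pg (i + k) x) := by
        filter_upwards [lt_mem_nhds hx] with z hz using ih z hz
      rw [e.deriv_eq]
      have h := (((hasDerivAt_id x).mul (pg_hasDerivAt (i + k + 1) (by omega) x hx)).sub
        ((pg_hasDerivAt (i + k) (by omega) x hx).const_mul ((k : ℝ) + α))).const_mul ((-1 : ℝ) ^ k)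
      refine h.deriv.trans ?_
      simp only [id, ← add_assoc]
      push_cast
      ring
  rw [main k x hx, ← mul_assoc, ← mul_pow]
  norm_num
  have h1 := key (i + k) (by omega) x hx
  have h2 : 0 ≤ pg (i + k) x := mul_nonneg (Nat.cast_nonneg _) (hurw_nonneg _ x hx)
  push_cast at h1
  nlinarith
end

section
/- For every positive integer i, every real β > 0, every real α, and every real x > 0, the identity (-1)^{i+1}[α ψ^{(i)}(x+β) + x ψ^{(i+1)}(x+β)] - (-1)^{i+1}[α ψ^{(i)}(x+β+1) + (x+1) ψ^{(i+1)}(x+β+1)] = ∫_0^∞ [t/(1-e^{-t}) + (β-1)t + α - i - 1] t^i e^{-(x+β)t} dt holds. -/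
open Real Set MeasureTheory Filter

namespace Stmt18Aux

noncomputable def lg (x : ℝ) : ℝ := Real.log (Real.Gamma x)

lemma lg_diff {y : ℝ} (hy : 0 < y) : DifferentiableAt ℝ lg y := by
  unfold lg
  refine DifferentiableAt.log (Real.differentiableAt_Gamma ?_) (Real.Gamma_pos_of_pos hy).ne'
  intro m h
  have : (0 : ℝ) ≤ m := m.cast_nonneg
  linarith

lemma lg_add_one {y : ℝ} (hy : 0 < y) : lg (y + 1) = lg y + Real.log y := by
  unfold lg
  rw [Real.Gamma_add_one hy.ne', Real.log_mul hy.ne' (Real.Gamma_pos_of_pos hy).ne']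
  ring

lemma dg_add_one {y : ℝ} (hy : 0 < y) : deriv lg (y + 1) = deriv lg y + 1 / y := by
  have h1 : HasDerivAt (fun z => lg (z + 1)) (deriv lg (y + 1)) y := by
    have := (lg_diff (by linarith : 0 < y + 1)).hasDerivAt
    exact this.comp_add_const y 1
  have h2 : HasDerivAt (fun z => lg z + Real.log z) (deriv lg y + y⁻¹) y :=
    (lg_diff hy).hasDerivAt.add (Real.hasDerivAt_log hy.ne')
  have h3 : (fun z => lg (z + 1)) =ᶠ[nhds y] (fun z => lg z + Real.log z) := by
    filter_upwards [lt_mem_nhds hy] with z hz using lg_add_one hz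
  rw [one_div]
  exact h1.unique (h2.congr_of_eventuallyEq h3)

lemma lg_convex : ConvexOn ℝ (Set.Ioi 0) lg := Real.convexOn_log_Gamma

lemma dg_le {y : ℝ} (hy : 0 < y) : deriv lg y ≤ Real.log y := by
  have h := lg_convex.deriv_le_slope (x := y) (y := y + 1) hy (by simp; linarith)
    (by linarith) (lg_diff hy)
  rw [slope_def_field, lg_add_one hy] at h
  simpa using h

lemma le_dg {y : ℝ} (hy : 0 < y) : Real.log y - 1 / y ≤ deriv lg y := by
  have h := lg_convex.slope_le_deriv (x := y) (y := y + 1) hy (by simp; linarith)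
    (by linarith) (lg_diff (by linarith))
  rw [slope_def_field, lg_add_one hy, dg_add_one hy] at h
  have : Real.log y ≤ deriv lg y + 1 / y := by simpa using h
  linarith

lemma tend_inv (y : ℝ) : Tendsto (fun n : ℕ => 1 / ((n : ℝ) + y)) atTop (nhds 0) := by
  simp_rw [one_div]
  exact tendsto_inv_atTop_zero.comp (tendsto_atTop_add_const_right _ _ tendsto_natCast_atTop_atTop)

lemma tend_dg {y : ℝ} (hy : 0 < y) :
    Tendsto (fun n : ℕ => deriv lg (n + y) - Real.log (n + y)) atTop (nhds 0) := by
  refine tendsto_of_tendsto_of_tendsto_of_le_of_le (g := fun n : ℕ => -(1 / ((n : ℝ) + y)))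
    (h := fun _ => 0) ?_ tendsto_const_nhds ?_ ?_
  · simpa using (tend_inv y).neg
  · intro n
    have : (0 : ℝ) < n + y := by positivity
    have := le_dg this
    simp only
    linarith
  · intro n
    have : (0 : ℝ) < n + y := by positivity
    have := dg_le this
    simp only
    linarith

lemma tend_log {y : ℝ} (hy : 0 < y) :
    Tendsto (fun n : ℕ => Real.log (n + 1) - Real.log (n + y)) atTop (nhds 0) := by
  have h1 : Tendsto (fun n : ℕ => 1 + (1 - y) * (1 / ((n : ℝ) + y))) atTop (nhds 1) := by
    simpa using ((tend_inv y).const_mul (1 - y)).const_add 1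
  have h2 := (Real.continuousAt_log one_ne_zero).tendsto.comp h1
  rw [Real.log_one] at h2
  refine h2.congr fun n => ?_
  have : (0 : ℝ) < n + y := by positivity
  have h : (0 : ℝ) < n + 1 := by positivity
  rw [← Real.log_div h.ne' this.ne']
  simp only [Function.comp]
  congr 1
  field_simp
  ring

lemma tend_sub {y : ℝ} (hy : 0 < y) :
    Tendsto (fun n : ℕ => deriv lg (n + 1) - deriv lg (n + y)) atTop (nhds 0) := by
  have := ((tend_dg one_pos).sub (tend_dg hy)).add (tend_log hy)
  simp only [sub_zero, add_zero] at this
  exact this.congr fun n => by ring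

lemma dg_partial {y : ℝ} (hy : 0 < y) (N : ℕ) :
    ∑ n ∈ Finset.range N, (1 / ((n : ℝ) + 1) - 1 / (n + y)) =
      deriv lg y - deriv lg 1 + (deriv lg (N + 1) - deriv lg (N + y)) := by
  induction N with
  | zero => simp
  | succ N ih =>
    rw [Finset.sum_range_succ, ih]
    have h1 := dg_add_one (y := N + y) (by positivity)
    have h2 := dg_add_one (y := (N : ℝ) + 1) (by positivity)
    push_cast
    rw [h2, show (N : ℝ) + 1 + y = N + y + 1 by ring, h1]
    ring

noncomputable def S (k : ℕ) (y : ℝ) : ℝ := ∑' n : ℕ, 1 / ((n : ℝ) + y) ^ k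

lemma summ {k : ℕ} (hk : 2 ≤ k) {y : ℝ} (hy : 0 < y) :
    Summable (fun n : ℕ => 1 / ((n : ℝ) + y) ^ k) := by
  have := (Real.summable_one_div_nat_add_rpow y k).2 (by exact_mod_cast hk)
  refine this.congr fun n => ?_
  have : (0 : ℝ) < n + y := by positivity
  rw [abs_of_pos this, Real.rpow_natCast]

lemma term_deriv (k : ℕ) (n : ℕ) {y : ℝ} (hy : 0 < y) :
    HasDerivAt (fun z : ℝ => 1 / ((n : ℝ) + z) ^ k) (-(k * (1 / ((n : ℝ) + y) ^ (k + 1)))) y := by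
  have h0 : (0 : ℝ) < n + y := by positivity
  have h1 : HasDerivAt (fun z : ℝ => (n : ℝ) + z) 1 y := (hasDerivAt_id y).const_add _
  have := (h1.pow k).inv (pow_pos h0 k).ne'
  simp_rw [one_div]
  refine this.congr_deriv ?_
  rcases k with _ | k
  · simp
  · simp only [Nat.add_sub_cancel]
    push_cast
    simp only [Pi.pow_apply]
    field_simp
    ring

lemma bound (k : ℕ) (n : ℕ) {a y : ℝ} (ha : 0 < a) (hy : a < y) :
    1 / ((n : ℝ) + y) ^ k ≤ 1 / ((n : ℝ) + a) ^ k := by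
  have : (0 : ℝ) < n + a := by positivity
  gcongr

lemma S_deriv {k : ℕ} (hk : 2 ≤ k) {y : ℝ} (hy : 0 < y) :
    HasDerivAt (S k) (-(k * S (k + 1) y)) y := by
  have ha : 0 < y / 2 := by linarith
  have := hasDerivAt_tsum_of_isPreconnected
    (g := fun (n : ℕ) (z : ℝ) => 1 / ((n : ℝ) + z) ^ k)
    (g' := fun (n : ℕ) (z : ℝ) => -(k * (1 / ((n : ℝ) + z) ^ (k + 1))))
    (u := fun n : ℕ => k * (1 / ((n : ℝ) + y / 2) ^ (k + 1))) (t := Set.Ioi (y / 2))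
    (y₀ := y) (y := y)
    ((summ (by omega) ha).mul_left _) isOpen_Ioi isPreconnected_Ioi
    (fun n z hz => term_deriv k n (ha.trans hz))
    (fun n z hz => by
      have h0 : (0 : ℝ) < n + z := by have := ha.trans hz; positivity
      rw [norm_neg, Real.norm_of_nonneg (by positivity)]
      gcongr ?_ * ?_
      exact bound _ n ha hz)
    (by simp; linarith) (summ hk hy) (by simp; linarith)
  rw [tsum_neg, tsum_mul_left] at this
  exact this

lemma ddg {y : ℝ} (hy : 0 < y) : HasDerivAt (deriv lg) (S 2 y) y := by
  set a := min y 1 / 2 with hadef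
  have hm : 0 < min y 1 := lt_min hy one_pos
  have ha : 0 < a := by linarith
  have hay : a < y := by have := min_le_left y 1; linarith
  have ha1 : a < 1 := by have := min_le_right y 1; linarith
  have hu : Summable (fun n : ℕ => 1 / ((n : ℝ) + a) ^ 2) := summ le_rfl ha
  have hg : ∀ (n : ℕ) (z : ℝ), z ∈ Set.Ioi a →
      HasDerivAt (fun z : ℝ => 1 / ((n : ℝ) + 1) - 1 / (n + z)) (1 / ((n : ℝ) + z) ^ 2) z := by
    intro n z hz
    have := (term_deriv 1 n (ha.trans hz)).const_sub (1 / ((n : ℝ) + 1))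
    simpa using this
  have hb : ∀ (n : ℕ) (z : ℝ), z ∈ Set.Ioi a →
      ‖1 / ((n : ℝ) + z) ^ 2‖ ≤ 1 / ((n : ℝ) + a) ^ 2 := by
    intro n z hz
    have h0 : (0 : ℝ) < n + z := by have := ha.trans hz; positivity
    rw [Real.norm_of_nonneg (by positivity)]
    exact bound _ n ha hz
  have h1 : Summable (fun n : ℕ => 1 / ((n : ℝ) + 1) - 1 / (n + (1 : ℝ))) := by
    simp
  have key := hasDerivAt_tsum_of_isPreconnected hu isOpen_Ioi isPreconnected_Ioi hg hb
    (y₀ := 1) ha1 h1 (y := y) hay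
  have hs : ∀ z ∈ Set.Ioi a, deriv lg z =
      deriv lg 1 + ∑' n : ℕ, (1 / ((n : ℝ) + 1) - 1 / (n + z)) := by
    intro z hz
    have hz0 : 0 < z := ha.trans hz
    have hsum := summable_of_summable_hasDerivAt_of_isPreconnected hu isOpen_Ioi isPreconnected_Ioi
      hg hb (y₀ := 1) ha1 h1 hz
    have t1 := hsum.hasSum.tendsto_sum_nat
    have t2 := (tend_sub hz0).const_add (deriv lg z - deriv lg 1)
    simp_rw [dg_partial hz0] at t1
    have := tendsto_nhds_unique t1 t2
    linarith
  refine (key.const_add (deriv lg 1)).congr_of_eventuallyEq ?_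
  filter_upwards [lt_mem_nhds hay] with z hz using hs z hz

lemma poly_eq (k : ℕ) : ∀ y : ℝ, 0 < y →
    polygamma (k + 1) y = (-1) ^ k * (k + 1).factorial * S (k + 2) y := by
  induction k with
  | zero =>
    intro y hy
    have : polygamma (0 + 1) = deriv (deriv lg) := by
      unfold polygamma
      rw [iteratedDeriv_succ]
      simp only [zero_add, iteratedDeriv_one]
      rfl
    rw [this, (ddg hy).deriv]
    simp
  | succ k ih =>
    intro y hy
    have : polygamma (k + 1 + 1) = deriv (polygamma (k + 1)) := by
      unfold polygamma
      rw [iteratedDeriv_succ]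
    rw [this]
    have h1 : polygamma (k + 1) =ᶠ[nhds y]
        (fun y => (-1) ^ k * (k + 1).factorial * S (k + 2) y) := by
      filter_upwards [lt_mem_nhds hy] with z hz using ih z hz
    rw [h1.deriv_eq, ((S_deriv (k := k + 2) (by omega) hy).const_mul _).deriv,
      Nat.factorial_succ (k + 1)]
    push_cast
    ring

lemma S_rec {k : ℕ} (hk : 2 ≤ k) {y : ℝ} (hy : 0 < y) : S k y = 1 / y ^ k + S k (y + 1) := by
  unfold S
  rw [(summ hk hy).tsum_eq_zero_add]
  simp only [Nat.cast_zero, zero_add, Nat.cast_add, Nat.cast_one]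
  congr 2
  ext n
  rw [show (n : ℝ) + 1 + y = n + (y + 1) by ring]

lemma S_pos {k : ℕ} (hk : 2 ≤ k) {y : ℝ} (hy : 0 < y) : 0 < S k y := by
  refine (summ hk hy).tsum_pos (fun n => by positivity) 0 (by simp; positivity)

lemma int_pow (k : ℕ) {r : ℝ} (hr : 0 < r) :
    ∫ t in Set.Ioi (0 : ℝ), t ^ k * Real.exp (-r * t) = k.factorial * (1 / r ^ (k + 1)) := by
  have := Real.integral_rpow_mul_exp_neg_mul_Ioi (a := (k : ℝ) + 1) (by positivity) hr
  rw [Real.Gamma_nat_eq_factorial] at this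
  have e : (k : ℝ) + 1 = ((k + 1 : ℕ) : ℝ) := by push_cast; ring
  rw [add_sub_cancel_right, e, Real.rpow_natCast] at this
  simp_rw [Real.rpow_natCast] at this
  rw [← one_div_pow, mul_comm, ← this]
  simp_rw [neg_mul]

lemma intble_pow (k : ℕ) {r : ℝ} (hr : 0 < r) :
    IntegrableOn (fun t : ℝ => t ^ k * Real.exp (-r * t)) (Set.Ioi 0) := by
  by_contra h
  have h1 := integral_undef h
  rw [int_pow k hr] at h1
  have : (0 : ℝ) < k.factorial * (1 / r ^ (k + 1)) := by positivity
  linarith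

lemma int_S {k : ℕ} (hk : 1 ≤ k) {y : ℝ} (hy : 0 < y) :
    ∫ t in Set.Ioi (0 : ℝ), t ^ k * Real.exp (-y * t) / (1 - Real.exp (-t)) =
      k.factorial * S (k + 1) y := by
  have hr : ∀ n : ℕ, (0 : ℝ) < n + y := fun n => by positivity
  have hnorm : ∀ n : ℕ, ∫ t in Set.Ioi (0 : ℝ), ‖t ^ k * Real.exp (-((n : ℝ) + y) * t)‖ =
      k.factorial * (1 / ((n : ℝ) + y) ^ (k + 1)) := by
    intro n
    rw [← int_pow k (hr n)]
    refine setIntegral_congr_fun measurableSet_Ioi fun t ht => ?_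
    have : (0 : ℝ) < t := ht
    exact Real.norm_of_nonneg (by positivity)
  have h := hasSum_integral_of_summable_integral_norm
    (F := fun (n : ℕ) (t : ℝ) => t ^ k * Real.exp (-((n : ℝ) + y) * t))
    (μ := volume.restrict (Set.Ioi 0)) (fun n => intble_pow k (hr n))
    (by simp_rw [hnorm]; exact (summ (by omega) hy).mul_left _)
  simp_rw [int_pow k (hr _)] at h
  have h2 := ((summ (k := k + 1) (by omega) hy).hasSum.mul_left (k.factorial : ℝ)).unique h
  rw [S, h2]
  refine setIntegral_congr_fun measurableSet_Ioi fun t ht => ?_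
  have ht : (0 : ℝ) < t := ht
  have he : Real.exp (-t) < 1 := by simpa using ht
  have hg := (hasSum_geometric_of_lt_one (Real.exp_pos (-t)).le he).mul_left
    (t ^ k * Real.exp (-y * t))
  rw [div_eq_mul_inv, ← hg.tsum_eq]
  refine tsum_congr fun n => ?_
  rw [mul_assoc, ← Real.exp_nat_mul, ← Real.exp_add]
  congr 2
  ring

lemma intble_S {k : ℕ} (hk : 1 ≤ k) {y : ℝ} (hy : 0 < y) :
    IntegrableOn (fun t : ℝ => t ^ k * Real.exp (-y * t) / (1 - Real.exp (-t))) (Set.Ioi 0) := by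
  by_contra h
  have h1 := integral_undef h
  rw [int_S hk hy] at h1
  have := S_pos (k := k + 1) (by omega) hy
  have : (0 : ℝ) < k.factorial * S (k + 1) y := by positivity
  linarith

end Stmt18Aux

open Stmt18Aux in
theorem stmt_18 (i : ℕ) (hi : 1 ≤ i) (β : ℝ) (hβ : 0 < β) (α : ℝ) (x : ℝ) (hx : 0 < x) :
    (-1 : ℝ) ^ (i + 1) * (α * polygamma i (x + β) + x * polygamma (i + 1) (x + β)) -
      (-1 : ℝ) ^ (i + 1) *
        (α * polygamma i (x + β + 1) + (x + 1) * polygamma (i + 1) (x + β + 1)) =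
      ∫ t in Set.Ioi (0 : ℝ),
        (t / (1 - Real.exp (-t)) + (β - 1) * t + α - i - 1) * t ^ i *
          Real.exp (-(x + β) * t) := by
  have hy : 0 < x + β := by linarith
  have hy1 : 0 < x + β + 1 := by linarith
  have hR : (∫ t in Set.Ioi (0 : ℝ),
        (t / (1 - Real.exp (-t)) + (β - 1) * t + α - i - 1) * t ^ i *
          Real.exp (-(x + β) * t)) =
      (i + 1).factorial * S (i + 2) (x + β) +
        (β - 1) * ((i + 1).factorial * (1 / (x + β) ^ (i + 2))) +
        (α - i - 1) * (i.factorial * (1 / (x + β) ^ (i + 1))) := by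
    rw [← int_S (k := i + 1) (by omega) hy, ← int_pow (i + 1) hy, ← int_pow i hy,
      ← integral_const_mul, ← integral_const_mul, ← integral_add, ← integral_add]
    · congr 1
      ext t
      ring
    · exact (intble_S (by omega) hy).add ((intble_pow (i + 1) hy).const_mul _)
    · exact (intble_pow i hy).const_mul _
    · exact intble_S (by omega) hy
    · exact (intble_pow (i + 1) hy).const_mul _
  rw [hR]
  obtain ⟨j, rfl⟩ : ∃ j, i = j + 1 := ⟨i - 1, by omega⟩
  rw [poly_eq j _ hy, poly_eq j _ hy1, poly_eq (j + 1) _ hy, poly_eq (j + 1) _ hy1,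
    S_rec (k := j + 2) (by omega) hy, S_rec (k := j + 1 + 2) (by omega) hy,
    Nat.factorial_succ (j + 1)]
  have hs : ((-1 : ℝ) ^ j) * (-1) ^ j = 1 := by
    rw [← mul_pow]; simp
  generalize hw : x + β = w at *
  have hβw : β = w - x := by linarith
  subst hβw
  generalize S (j + 1 + 2) (w + 1) = s
  generalize S (j + 2) (w + 1) = s'
  rw [pow_succ (-1 : ℝ) (j + 1), pow_succ (-1 : ℝ) j]
  generalize ((-1 : ℝ) ^ j) = e at *
  push_cast
  have hwe : 1 / w ^ (j + 1 + 1) = w * (1 / w ^ (j + 1 + 2)) := by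
    field_simp
    ring
  rw [hwe]
  generalize 1 / w ^ (j + 1 + 2) = q
  generalize ((j + 1).factorial : ℝ) = F
  have hs' : e ^ 2 = 1 := by rw [sq, hs]
  linear_combination (α * F * w * q - x * (j + 2) * F * q + (j + 2) * F * s) * hs'
end
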